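/- arXiv:1502.06840 — 2 statements merged into one kernel-verified Lean document; each statement's English description precedes it below -/
import Mathlib

section
/- Let p and q be primes with p dividing q − 1 and p odd, and let G_{q,p} = V ⋊ H be as defined. Then md(G_{q,p}) = p. -/
/-- `V = F_q^p`, the `p`-dimensional vector space over the field with `q` elements. -/
abbrev Vqp (q p : ℕ) : Type := Fin p → ZMod q

/-- The permutation of `V = F_q^p` multiplying the `i`-th coordinate by the unit `c`. -/
def scalePerm (q p : ℕ) [Fact q.Prime] (c : (ZMod q)ˣ) (i : Fin p) : Equiv.Perm (Vqp q p) :=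
  Equiv.piCongrRight fun j =>
    if j = i then Equiv.mulLeft₀ (c : ZMod q) c.ne_zero else Equiv.refl _

/-- The permutation of `V = F_q^p` induced by a permutation `e` of the coordinates:
`(f_1, …, f_p) ↦ (f_{1 e⁻¹}, …, f_{p e⁻¹})`. -/
def coordPerm (q p : ℕ) (e : Equiv.Perm (Fin p)) : Equiv.Perm (Vqp q p) :=
  Equiv.arrowCongr e (Equiv.refl (ZMod q))

/-- The wreath product `H = C ≀ ⟨σ⟩` realized inside `Perm V`: the subgroup generated by the
scalings by `c` at each coordinate (which generate the base group `C^p`) together with the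
cyclic coordinate permutation `σ = (1 2 … p)`.  Here `C = ⟨c⟩` is the subgroup of order `p`
of `F_q^*`. -/
def Hqp (q p : ℕ) [Fact q.Prime] (c : (ZMod q)ˣ) : Subgroup (Equiv.Perm (Vqp q p)) :=
  Subgroup.closure (Set.range (scalePerm q p c) ∪ {coordPerm q p (finRotate p)})

/-- The group of translations of `V`, realized inside `Perm V`. -/
def Vtrans (q p : ℕ) : Subgroup (Equiv.Perm (Vqp q p)) :=
  Subgroup.closure (Set.range fun v : Vqp q p => Equiv.addLeft v)

/-- `G_{q,p} = V ⋊ H`, realized as the group of permutations of `V` of the form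
`x ↦ x^h + v` with `h ∈ H`, `v ∈ V` (the action of `V ⋊ H` on `V` is faithful). -/
def Gqp (q p : ℕ) [Fact q.Prime] (c : (ZMod q)ˣ) : Subgroup (Equiv.Perm (Vqp q p)) :=
  Vtrans q p ⊔ Hqp q p c

/-- A family of subgroups `H i` of `G` is in *general position* if for every index `i`,
the intersection of the `H j` with `j ≠ i` properly contains the intersection of all the
`H j`. -/
def GeneralPosition {G : Type*} [Group G] {ι : Type*} (H : ι → Subgroup G) : Prop :=
  ∀ i : ι, (⨅ j, H j) < ⨅ j ∈ ({i}ᶜ : Set ι), H j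

/-- `mdInv G` is the maximum size of a family of maximal subgroups of `G` in general
position. -/
noncomputable def mdInv (G : Type*) [Group G] : ℕ :=
  sSup {n | ∃ M : Fin n → Subgroup G, (∀ i, IsCoatom (M i)) ∧ GeneralPosition M}

section GenericLemmas

theorem pow_val_add {A : Type*} [Monoid A] {n : ℕ} [NeZero n] {a : A} (ha : a ^ n = 1)
    (k l : ZMod n) : a ^ (k + l).val = a ^ k.val * a ^ l.val := by
  rw [ZMod.val_add, ← pow_add, ← pow_eq_pow_mod _ ha]

theorem pow_val_injective {A : Type*} [Group A] {n : ℕ} [NeZero n] {a : A} (ha : orderOf a = n) :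
    Function.Injective fun k : ZMod n => a ^ k.val := by
  intro k l h
  have h' := pow_inj_mod.1 h
  rw [ha, Nat.mod_eq_of_lt k.val_lt, Nat.mod_eq_of_lt l.val_lt] at h'
  exact ZMod.val_injective n h'

theorem pow_val_neg {A : Type*} [Group A] {n : ℕ} [NeZero n] {a : A} (ha : a ^ n = 1)
    (k : ZMod n) : a ^ (-k).val = (a ^ k.val)⁻¹ := by
  rw [eq_inv_iff_mul_eq_one, ← pow_val_add ha]
  simp

/-- If subgroups `N j` contain the kernel of a homomorphism `φ` to a vector space over `ZMod p`
and `x i ∈ N j ↔ i ≠ j`, then the vectors `φ (x i)` are linearly independent. -/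
theorem linearIndependent_of_generalPosition {p : ℕ} [Fact p.Prime] {G W ι : Type*} [Group G]
    [AddCommGroup W] [Module (ZMod p) W] (φ : G →* Multiplicative W) (N : ι → Subgroup G)
    (hN : ∀ j, φ.ker ≤ N j) (x : ι → G) (hx : ∀ i j, i ≠ j → x i ∈ N j)
    (hx' : ∀ i, x i ∉ N i) :
    LinearIndependent (ZMod p) fun i => (φ (x i)).toAdd := by
  rw [linearIndependent_iff_notMem_span]
  intro j hj
  let A : AddSubgroup W :=
    { carrier := {w | ∃ g ∈ N j, (φ g).toAdd = w}
      zero_mem' := ⟨1, one_mem _, by simp⟩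
      add_mem' := by
        rintro _ _ ⟨g, hg, rfl⟩ ⟨h, hh, rfl⟩
        exact ⟨g * h, mul_mem hg hh, by simp⟩
      neg_mem' := by
        rintro _ ⟨g, hg, rfl⟩
        exact ⟨g⁻¹, inv_mem hg, by simp⟩ }
  have hle : Submodule.span (ZMod p) ((fun i => (φ (x i)).toAdd) '' (Set.univ \ {j})) ≤
      AddSubgroup.toZModSubmodule p A := by
    rw [Submodule.span_le]
    rintro _ ⟨i, hi, rfl⟩
    exact ⟨x i, hx i j (by simpa using hi), rfl⟩
  obtain ⟨g, hg, hgx⟩ := hle hj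
  apply hx' j
  have h1 : x j * g⁻¹ ∈ N j := by
    apply hN
    rw [MonoidHom.mem_ker, map_mul, map_inv, mul_inv_eq_one]
    exact Multiplicative.toAdd.injective hgx.symm
  simpa using mul_mem h1 hg

theorem finRotate_isCycle_of_prime (p : ℕ) [hp : Fact p.Prime] :
    (finRotate p).IsCycle ∧ (finRotate p).support = Finset.univ := by
  obtain ⟨n, rfl⟩ : ∃ n, p = n + 2 := ⟨p - 2, by have := hp.out.two_le; omega⟩
  exact ⟨isCycle_finRotate, support_finRotate⟩

theorem orderOf_finRotate_of_prime (p : ℕ) [Fact p.Prime] : orderOf (finRotate p) = p := by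
  obtain ⟨h, h'⟩ := finRotate_isCycle_of_prime p
  rw [h.orderOf, h']
  simp

/-- The `k`-th power of the cycle `finRotate p`, for `k` modulo `p`. -/
abbrev rot (p : ℕ) (k : ZMod p) : Equiv.Perm (Fin p) := finRotate p ^ k.val

variable {p : ℕ} [Fact p.Prime]

theorem finRotate_pow_prime : finRotate p ^ p = 1 := by
  conv_lhs => rw [← pow_mod_orderOf, orderOf_finRotate_of_prime, Nat.mod_self, pow_zero]

theorem rot_add (k l : ZMod p) : rot p (k + l) = rot p k * rot p l :=
  pow_val_add finRotate_pow_prime k l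

theorem rot_neg (k : ZMod p) : rot p (-k) = (rot p k)⁻¹ :=
  pow_val_neg finRotate_pow_prime k

theorem rot_zero : rot p 0 = 1 := by simp [rot]

theorem rot_one : rot p 1 = finRotate p := by
  simp [rot, ZMod.val_one'' (Fact.out : p.Prime).ne_one]

theorem rot_injective : Function.Injective (rot p) :=
  pow_val_injective (orderOf_finRotate_of_prime p)

theorem exists_rot_eq (i j : Fin p) : ∃ k, rot p k i = j := by
  obtain ⟨h, h'⟩ := finRotate_isCycle_of_prime p
  have hs : ∀ i, finRotate p i ≠ i := fun i => by
    rw [← Equiv.Perm.mem_support, h']; simp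
  obtain ⟨z, hz⟩ := h.exists_zpow_eq (hs i) (hs j)
  refine ⟨(z : ZMod p), ?_⟩
  rw [← hz]
  congr 1
  have h1 := ZMod.val_intCast (n := p) z
  have h2 := zpow_mod_orderOf (finRotate p) z
  rw [orderOf_finRotate_of_prime] at h2
  rw [rot, ← zpow_natCast, h1, h2]

theorem rot_nsmul (n : ℕ) (k : ZMod p) : rot p (n • k) = rot p k ^ n := by
  induction n with
  | zero => simp [rot_zero]
  | succ n ih => rw [succ_nsmul, rot_add, ih, pow_succ]

/-- A set of indices stable under a nontrivial rotation is empty or everything. -/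
theorem forall_of_rot_stable {k : ZMod p} (hk : k ≠ 0) {P : Fin p → Prop}
    (hP : ∀ i, P i → P (rot p k i)) {i : Fin p} (hi : P i) (j : Fin p) : P j := by
  obtain ⟨l, rfl⟩ := exists_rot_eq i j
  have hl : l = (l * k⁻¹).val • k := by
    rw [nsmul_eq_mul, ZMod.natCast_zmod_val]; field_simp
  rw [hl, rot_nsmul]
  generalize (l * k⁻¹).val = n
  induction n with
  | zero => simpa
  | succ n ih => rw [pow_succ', Equiv.Perm.mul_apply]; exact hP _ ih

end GenericLemmas

section Representation

variable {p q : ℕ} [Fact q.Prime]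

/-- The scalar `c ^ k`, for `k` modulo `p`. -/
abbrev scal (c : (ZMod q)ˣ) (k : ZMod p) : ZMod q := ((c ^ k.val : (ZMod q)ˣ) : ZMod q)

/-- The permutation `g` of `V` is the affine map with scaling exponents `m`, rotation `k` and
translation vector `v`. -/
def IsAffine (c : (ZMod q)ˣ) (g : Equiv.Perm (Vqp q p)) (m : Fin p → ZMod p) (k : ZMod p)
    (v : Vqp q p) : Prop :=
  ∀ x i, g x i = scal c (m i) * x ((rot p k)⁻¹ i) + v i

theorem scal_ne_zero (c : (ZMod q)ˣ) (k : ZMod p) : scal c k ≠ 0 := Units.ne_zero _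

theorem scal_zero (c : (ZMod q)ˣ) : scal c (0 : ZMod p) = 1 := by simp [scal]

variable [Fact p.Prime]

theorem isAffine_one (c : (ZMod q)ˣ) : IsAffine c (1 : Equiv.Perm (Vqp q p)) 0 0 0 := fun x i => by
  simp [rot_zero]

theorem isAffine_addLeft (c : (ZMod q)ˣ) (v : Vqp q p) : IsAffine c (Equiv.addLeft v) 0 0 v :=
  fun x i => by simp [add_comm, rot_zero]

theorem isAffine_scalePerm (c : (ZMod q)ˣ) (i : Fin p) :
    IsAffine c (scalePerm q p c i) (Pi.single i 1) 0 0 := fun x j => by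
  by_cases h : j = i
  · subst h
    simp [scalePerm, Pi.map, rot_zero, ZMod.val_one'' (Fact.out : p.Prime).ne_one]
  · simp [scalePerm, Pi.map, h, rot_zero]

theorem isAffine_coordPerm (c : (ZMod q)ˣ) :
    IsAffine c (coordPerm q p (finRotate p)) 0 1 0 := fun x j => by
  simp [coordPerm, rot_one, Equiv.arrowCongr, Equiv.Perm.inv_def]

section Group

variable (c : (ZMod q)ˣ)

/-- Translation by `v`, as an element of `G`. -/
def translG (v : Vqp q p) : Gqp q p c :=
  ⟨Equiv.addLeft v, Subgroup.mem_sup_left (Subgroup.subset_closure ⟨v, rfl⟩)⟩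

/-- Scaling of the coordinate `i` by `c`, as an element of `G`. -/
def scaleG (i : Fin p) : Gqp q p c :=
  ⟨scalePerm q p c i, Subgroup.mem_sup_right (Subgroup.subset_closure (Or.inl ⟨i, rfl⟩))⟩

/-- The cyclic rotation of the coordinates, as an element of `G`. -/
def rotG : Gqp q p c :=
  ⟨coordPerm q p (finRotate p), Subgroup.mem_sup_right (Subgroup.subset_closure (Or.inr rfl))⟩

variable {c}

omit [Fact p.Prime] in
theorem Gqp_induction {P : Gqp q p c → Prop} (htransl : ∀ v, P (translG c v))
    (hscale : ∀ i, P (scaleG c i)) (hrot : P (rotG c)) (hone : P 1)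
    (hmul : ∀ g h, P g → P h → P (g * h)) (hinv : ∀ g, P g → P g⁻¹) (g : Gqp q p c) : P g := by
  have hG : Gqp q p c = Subgroup.closure ((Set.range fun v : Vqp q p => Equiv.addLeft v) ∪
      (Set.range (scalePerm q p c) ∪ {coordPerm q p (finRotate p)})) := by
    rw [Subgroup.closure_union]; rfl
  have key : ∀ x (_ : x ∈ Subgroup.closure ((Set.range fun v : Vqp q p => Equiv.addLeft v) ∪
      (Set.range (scalePerm q p c) ∪ {coordPerm q p (finRotate p)}))),
      ∀ h : x ∈ Gqp q p c, P ⟨x, h⟩ := by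
    intro x hx
    induction hx using Subgroup.closure_induction with
    | mem x hx =>
      intro h
      rcases hx with ⟨v, rfl⟩ | ⟨i, rfl⟩ | rfl
      exacts [htransl v, hscale i, hrot]
    | one => exact fun _ => hone
    | mul x y hx hy ihx ihy =>
      rw [← hG] at hx hy
      exact fun _ => hmul ⟨x, hx⟩ ⟨y, hy⟩ (ihx hx) (ihy hy)
    | inv x hx ih =>
      rw [← hG] at hx
      exact fun _ => hinv ⟨x, hx⟩ (ih hx)
  exact key g (hG ▸ g.2) g.2

end Group

variable {c : (ZMod q)ˣ} (hc : orderOf c = p)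

include hc

theorem scal_add (k l : ZMod p) : scal c (k + l) = scal c k * scal c l := by
  rw [scal, pow_val_add (hc ▸ pow_orderOf_eq_one c), Units.val_mul]

theorem scal_injective : Function.Injective fun k : ZMod p => scal c k :=
  Units.val_injective.comp (pow_val_injective hc)

theorem scal_eq_one {k : ZMod p} : scal c k = 1 ↔ k = 0 := by
  rw [← scal_zero (p := p) c]
  exact (scal_injective hc).eq_iff

theorem IsAffine.mul {g h : Equiv.Perm (Vqp q p)} {m n : Fin p → ZMod p} {k l : ZMod p}
    {v w : Vqp q p} (hg : IsAffine c g m k v) (hh : IsAffine c h n l w) :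
    IsAffine c (g * h) (fun i => m i + n ((rot p k)⁻¹ i)) (k + l)
      (fun i => scal c (m i) * w ((rot p k)⁻¹ i) + v i) := fun x i => by
  rw [Equiv.Perm.mul_apply, hg, hh, scal_add hc, rot_add, mul_inv_rev, Equiv.Perm.mul_apply]
  ring

theorem IsAffine.inv {g : Equiv.Perm (Vqp q p)} {m : Fin p → ZMod p} {k : ZMod p}
    {v : Vqp q p} (hg : IsAffine c g m k v) :
    IsAffine c g⁻¹ (fun i => -m (rot p k i)) (-k)
      (fun i => -(scal c (-m (rot p k i)) * v (rot p k i))) := fun y i => by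
  have h := hg (g⁻¹ y) (rot p k i)
  rw [show g (g⁻¹ y) = y from g.apply_symm_apply y,
    show (rot p k)⁻¹ (rot p k i) = i from (rot p k).symm_apply_apply i] at h
  rw [rot_neg, inv_inv, h]
  have h1 : scal c (-m (rot p k i)) * scal c (m (rot p k i)) = 1 := by
    rw [← scal_add hc, neg_add_cancel, scal_zero]
  linear_combination (-(g⁻¹ y i)) * h1

theorem exists_isAffine (g : Gqp q p c) :
    ∃ m k v, IsAffine c (g : Equiv.Perm (Vqp q p)) m k v := by
  induction g using Gqp_induction with
  | htransl v => exact ⟨_, _, _, isAffine_addLeft c v⟩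
  | hscale i => exact ⟨_, _, _, isAffine_scalePerm c i⟩
  | hrot => exact ⟨_, _, _, isAffine_coordPerm c⟩
  | hone => exact ⟨_, _, _, isAffine_one c⟩
  | hmul g h hg hh =>
    obtain ⟨_, _, _, hg⟩ := hg
    obtain ⟨_, _, _, hh⟩ := hh
    exact ⟨_, _, _, hg.mul hc hh⟩
  | hinv g hg =>
    obtain ⟨_, _, _, hg⟩ := hg
    exact ⟨_, _, _, hg.inv hc⟩

theorem IsAffine.unique {g : Equiv.Perm (Vqp q p)} {m n : Fin p → ZMod p} {k l : ZMod p}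
    {v w : Vqp q p} (hg : IsAffine c g m k v) (hh : IsAffine c g n l w) :
    m = n ∧ k = l ∧ v = w := by
  have hv : v = w := by
    funext i
    have h1 := hg 0 i
    have h2 := hh 0 i
    simp only [Pi.zero_apply, mul_zero, zero_add] at h1 h2
    rw [← h1, h2]
  subst hv
  have key : ∀ (x : Vqp q p) i,
      scal c (m i) * x ((rot p k)⁻¹ i) = scal c (n i) * x ((rot p l)⁻¹ i) :=
    fun x i => add_right_cancel ((hg x i).symm.trans (hh x i))
  have hk : k = l := by
    apply rot_injective
    rw [← inv_inj]
    ext1 i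
    by_contra hne
    have h1 := key (Pi.single ((rot p k)⁻¹ i) 1) i
    rw [Pi.single_eq_same, Pi.single_eq_of_ne (Ne.symm hne), mul_one, mul_zero] at h1
    exact scal_ne_zero _ _ h1
  subst hk
  refine ⟨funext fun i => scal_injective hc ?_, rfl, rfl⟩
  simpa using key 1 i

end Representation

section AffineData

variable {p q : ℕ} [Fact q.Prime] [Fact p.Prime] {c : (ZMod q)ˣ} (hc : orderOf c = p)

/-- The exponents of the scalings in the linear part of `g`. -/
noncomputable def expo (g : Gqp q p c) : Fin p → ZMod p := (exists_isAffine hc g).choose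

/-- The rotation amount of the linear part of `g`. -/
noncomputable def shift (g : Gqp q p c) : ZMod p := (exists_isAffine hc g).choose_spec.choose

/-- The translation part of `g`. -/
noncomputable def transVec (g : Gqp q p c) : Vqp q p :=
  (exists_isAffine hc g).choose_spec.choose_spec.choose

theorem isAffine (g : Gqp q p c) :
    IsAffine c (g : Equiv.Perm (Vqp q p)) (expo hc g) (shift hc g) (transVec hc g) :=
  (exists_isAffine hc g).choose_spec.choose_spec.choose_spec

theorem expo_eq {g : Gqp q p c} {m k v} (h : IsAffine c (g : Equiv.Perm (Vqp q p)) m k v) :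
    expo hc g = m := ((isAffine hc g).unique hc h).1

theorem shift_eq {g : Gqp q p c} {m k v} (h : IsAffine c (g : Equiv.Perm (Vqp q p)) m k v) :
    shift hc g = k := ((isAffine hc g).unique hc h).2.1

omit [Fact p.Prime] in
theorem eq_of_isAffine {g h : Gqp q p c} {m k v} (hg : IsAffine c (g : Equiv.Perm (Vqp q p)) m k v)
    (hh : IsAffine c (h : Equiv.Perm (Vqp q p)) m k v) : g = h := by
  apply Subtype.ext
  ext x i
  rw [hg, hh]

theorem expo_mul (g h : Gqp q p c) :
    expo hc (g * h) = fun i => expo hc g i + expo hc h ((rot p (shift hc g))⁻¹ i) :=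
  expo_eq hc ((isAffine hc g).mul hc (isAffine hc h))

theorem shift_mul (g h : Gqp q p c) : shift hc (g * h) = shift hc g + shift hc h :=
  shift_eq hc ((isAffine hc g).mul hc (isAffine hc h))

/-- The rotation amount as a homomorphism. -/
noncomputable def shiftHom : Gqp q p c →* Multiplicative (ZMod p) :=
  MonoidHom.mk' (fun g => Multiplicative.ofAdd (shift hc g)) fun g h => by
    rw [shift_mul, ofAdd_add]

/-- The sum of the exponents of the scalings, as a homomorphism. -/
noncomputable def sumHom : Gqp q p c →* Multiplicative (ZMod p) :=
  MonoidHom.mk' (fun g => Multiplicative.ofAdd (∑ i, expo hc g i)) fun g h => by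
    rw [← ofAdd_add, expo_mul, Finset.sum_add_distrib]
    congr 2
    exact Equiv.sum_comp (rot p (shift hc g))⁻¹ (expo hc h)

theorem shiftHom_eq_one {g : Gqp q p c} : shiftHom hc g = 1 ↔ shift hc g = 0 := ofAdd_eq_one

theorem sumHom_eq_one {g : Gqp q p c} : sumHom hc g = 1 ↔ ∑ i, expo hc g i = 0 := ofAdd_eq_one

/-- The translation subgroup of `G`. -/
def translSub (c : (ZMod q)ˣ) : Subgroup (Gqp q p c) where
  carrier := Set.range (translG c)
  one_mem' := ⟨0, by ext x i; simp [translG]⟩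
  mul_mem' := by
    rintro _ _ ⟨v, rfl⟩ ⟨w, rfl⟩
    exact ⟨v + w, by ext x i; simp [translG]⟩
  inv_mem' := by
    rintro _ ⟨v, rfl⟩
    exact ⟨-v, by ext x i; simp [translG]⟩

include hc

theorem mem_translSub {g : Gqp q p c} :
    g ∈ translSub c ↔ shift hc g = 0 ∧ expo hc g = 0 := by
  constructor
  · rintro ⟨v, rfl⟩
    exact ⟨shift_eq hc (isAffine_addLeft c v), expo_eq hc (isAffine_addLeft c v)⟩
  · rintro ⟨h1, h2⟩
    have h := isAffine hc g
    rw [h1, h2] at h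
    exact ⟨transVec hc g, eq_of_isAffine (isAffine_addLeft c _) h⟩

theorem shift_one : shift hc (1 : Gqp q p c) = 0 := shift_eq hc (isAffine_one c)

theorem expo_one : expo hc (1 : Gqp q p c) = 0 := expo_eq hc (isAffine_one c)

theorem shift_pow (g : Gqp q p c) (n : ℕ) : shift hc (g ^ n) = n • shift hc g := by
  induction n with
  | zero => simp [shift_one]
  | succ n ih => rw [pow_succ, shift_mul, ih, succ_nsmul]

theorem expo_pow {g : Gqp q p c} (hg : shift hc g = 0) (n : ℕ) :
    expo hc (g ^ n) = n • expo hc g := by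
  induction n with
  | zero => simp [expo_one]
  | succ n ih =>
    rw [pow_succ', expo_mul, ih, succ_nsmul', hg, rot_zero]
    rfl

theorem pow_mem_translSub (g : Gqp q p c) : g ^ p ^ 2 ∈ translSub c := by
  have h : shift hc (g ^ p) = 0 := by rw [shift_pow]; simp
  rw [mem_translSub hc, pow_two, pow_mul, shift_pow, h, expo_pow hc h]
  exact ⟨smul_zero _, by ext i; simp⟩

theorem translSub_normal : (translSub c : Subgroup (Gqp q p c)).Normal where
  conj_mem n hn g := by
    rw [mem_translSub hc] at hn ⊢
    have h1 : g * n * g⁻¹ * g = g * n := by group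
    have hs := congrArg (shift hc) h1
    have he := congrArg (expo hc) h1
    rw [shift_mul hc _ g, shift_mul hc g n, hn.1, add_zero, add_eq_right] at hs
    rw [expo_mul hc _ g, expo_mul hc g n, hs, hn.2] at he
    refine ⟨hs, funext fun i => ?_⟩
    simpa [rot_zero] using congrFun he i

theorem rotG_mul_scaleG (i : Fin p) :
    rotG c * scaleG c i = scaleG c (rot p 1 i) * rotG c := by
  refine eq_of_isAffine ((isAffine_coordPerm c).mul hc (isAffine_scalePerm c i)) ?_
  convert (isAffine_scalePerm c (rot p 1 i)).mul hc (isAffine_coordPerm c) using 1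
  · rfl
  · funext j
    simp [Pi.single_apply, Equiv.symm_apply_eq]
  · simp
  · funext j
    simp

/-- A homomorphism from `G` to a commutative group that kills translations also kills the
diagonal elements whose exponents sum to zero. -/
theorem map_eq_one_of_sum_eq_zero {A : Type*} [CommGroup A] (f : Gqp q p c →* A)
    (hf : ∀ v, f (translG c v) = 1) {g : Gqp q p c} (hs : shift hc g = 0)
    (he : ∑ i, expo hc g i = 0) : f g = 1 := by
  have hT : ∀ t ∈ translSub c, f t = 1 := by
    rintro _ ⟨v, rfl⟩
    exact hf v
  obtain ⟨i₀⟩ : Nonempty (Fin p) := ⟨⟨0, (Fact.out : p.Prime).pos⟩⟩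
  have hscale : ∀ i, f (scaleG c i) = f (scaleG c i₀) := by
    intro i
    refine forall_of_rot_stable (p := p) one_ne_zero
      (P := fun i => f (scaleG c i) = f (scaleG c i₀)) (fun j hj => ?_) rfl i
    have h := congrArg f (rotG_mul_scaleG hc j)
    rw [map_mul, map_mul, mul_comm] at h
    exact (mul_right_cancel h).symm.trans hj
  have ha : f (scaleG c i₀) ^ p = 1 := by
    rw [← map_pow]
    apply hT
    have h0 : shift hc (scaleG c i₀) = 0 := shift_eq hc (isAffine_scalePerm c i₀)
    rw [mem_translSub hc, shift_pow, expo_pow hc h0, h0]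
    exact ⟨smul_zero _, by ext i; simp⟩
  have hb : f (rotG c) ^ p = 1 := by
    rw [← map_pow]
    apply hT
    rw [mem_translSub hc, shift_pow]
    refine ⟨by simp, ?_⟩
    have h0 : ∀ n, expo hc (rotG c ^ n) = 0 := fun n => by
      induction n with
      | zero => rw [pow_zero, expo_one]
      | succ n ih =>
        rw [pow_succ, expo_mul, ih, expo_eq hc (isAffine_coordPerm c)]
        funext i
        simp
    exact h0 p
  have key : ∀ g, f g =
      f (scaleG c i₀) ^ (∑ i, expo hc g i).val * f (rotG c) ^ (shift hc g).val := by
    intro g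
    induction g using Gqp_induction with
    | htransl v =>
      rw [hf, expo_eq hc (isAffine_addLeft c v), shift_eq hc (isAffine_addLeft c v)]
      simp
    | hscale i =>
      rw [hscale, expo_eq hc (isAffine_scalePerm c i), shift_eq hc (isAffine_scalePerm c i)]
      simp [ZMod.val_one'' (Fact.out : p.Prime).ne_one]
    | hrot =>
      rw [expo_eq hc (isAffine_coordPerm c), shift_eq hc (isAffine_coordPerm c)]
      simp [ZMod.val_one'' (Fact.out : p.Prime).ne_one]
    | hone => simp [expo_one, shift_one]
    | hmul g h hg hh =>
      rw [map_mul, hg, hh, shift_mul]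
      have hsum : ∑ i, expo hc (g * h) i = ∑ i, expo hc g i + ∑ i, expo hc h i :=
        congrArg Multiplicative.toAdd ((sumHom hc).map_mul g h)
      rw [hsum, pow_val_add ha, pow_val_add hb, mul_mul_mul_comm]
    | hinv g hg =>
      have hsum : ∑ i, expo hc g⁻¹ i = - ∑ i, expo hc g i :=
        congrArg Multiplicative.toAdd ((sumHom hc).map_inv g)
      have hsh : shift hc g⁻¹ = - shift hc g :=
        congrArg Multiplicative.toAdd ((shiftHom hc).map_inv g)
      rw [map_inv, hg, hsum, hsh, pow_val_neg ha, pow_val_neg hb, mul_inv]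
  rw [key, hs, he]
  simp

end AffineData

section MaximalSubgroups

variable {p q : ℕ} [Fact q.Prime] {c : (ZMod q)ˣ}

theorem translG_add (v w : Vqp q p) : translG c (v + w) = translG c v * translG c w := by
  ext x i; simp [translG]

theorem translG_zero : translG c (0 : Vqp q p) = 1 := by
  ext x i; simp [translG]

theorem translG_neg (v : Vqp q p) : translG c (-v) = (translG c v)⁻¹ := by
  ext x i; simp [translG]

theorem translG_mem (v : Vqp q p) : translG c v ∈ translSub c := ⟨v, rfl⟩

theorem translG_smul (v x : Vqp q p) : translG c v • x = v + x := rfl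

theorem translG_mul_comm (v w : Vqp q p) :
    translG c v * translG c w = translG c w * translG c v := by
  rw [← translG_add, add_comm, translG_add]

theorem scaleG_smul (i : Fin p) (v : Vqp q p) :
    scaleG c i • v = v + Pi.single i (((c : ZMod q) - 1) * v i) := by
  funext j
  by_cases h : j = i
  · subst h
    have : (scaleG c j • v) j = (c : ZMod q) * v j := by
      change scalePerm q p c j v j = _
      simp [scalePerm, Pi.map]
    rw [this, Pi.add_apply, Pi.single_eq_same]
    ring
  · rw [Pi.add_apply, Pi.single_eq_of_ne h]
    change scalePerm q p c i v j = _
    simp [scalePerm, Pi.map, h]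

theorem stabilizer_sup_translSub (w : Vqp q p) :
    MulAction.stabilizer (Gqp q p c) w ⊔ translSub c = ⊤ := by
  rw [eq_top_iff]
  intro g _
  have h : g = translG c (g • w - w) * (translG c (-(g • w - w)) * g) := by
    rw [translG_neg, mul_inv_cancel_left]
  rw [h]
  refine mul_mem (Subgroup.mem_sup_right (translG_mem _)) (Subgroup.mem_sup_left ?_)
  rw [MulAction.mem_stabilizer_iff, mul_smul, translG_smul]
  abel

variable [Fact p.Prime]

theorem rotG_smul_single (i : Fin p) (a : ZMod q) :
    (rotG c : Gqp q p c) • (Pi.single i a : Vqp q p) =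
    (Pi.single (rot p 1 i) a : Vqp q p) := by
  funext j
  rw [rot_one]
  change (Pi.single i a : Vqp q p) ((finRotate p).symm j) = _
  simp only [Pi.single_apply, Equiv.symm_apply_eq]

theorem stabilizer_ne_top (w : Vqp q p) : MulAction.stabilizer (Gqp q p c) w ≠ ⊤ := by
  intro h
  have h1 : translG c (1 : Vqp q p) ∈ MulAction.stabilizer (Gqp q p c) w := h ▸ Subgroup.mem_top _
  rw [MulAction.mem_stabilizer_iff, translG_smul, add_eq_right] at h1
  exact one_ne_zero (congrFun h1 ⟨0, (Fact.out : p.Prime).pos⟩)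

variable (hc : orderOf c = p)

include hc

theorem smul_eq (g : Gqp q p c) (x : Vqp q p) (i : Fin p) :
    (g • x) i = scal c (expo hc g i) * x ((rot p (shift hc g))⁻¹ i) + transVec hc g i :=
  isAffine hc g x i

theorem mul_translG (g : Gqp q p c) (v : Vqp q p) :
    g * translG c v = translG c (g • v - g • (0 : Vqp q p)) * g := by
  have h : ∀ x : Vqp q p,
      (g * translG c v) • x = (translG c (g • v - g • (0 : Vqp q p)) * g) • x := by
    intro x
    funext i
    rw [mul_smul, mul_smul, translG_smul, translG_smul]
    simp only [Pi.add_apply, Pi.sub_apply, smul_eq hc, Pi.zero_apply]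
    ring
  exact Subtype.ext (Equiv.ext h)

theorem coe_ne_one : (c : ZMod q) ≠ 1 := fun h => by
  have h1 : c = 1 := Units.ext h
  rw [h1, orderOf_one] at hc
  exact (Fact.out : p.Prime).ne_one hc.symm

/-- `V` is an irreducible module: a supplement of `V` containing a nontrivial translation is the
whole group. -/
theorem eq_top_of_translG_mem {L : Subgroup (Gqp q p c)} (hL : L ⊔ translSub c = ⊤)
    {v : Vqp q p} (hv : v ≠ 0) (hvL : translG c v ∈ L) : L = ⊤ := by
  have := translSub_normal hc
  let U₀ : AddSubgroup (Vqp q p) :=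
    { carrier := {v | translG c v ∈ L}
      zero_mem' := by simp [translG_zero]
      add_mem' := fun {a b} ha hb => by
        rw [Set.mem_ofPred_eq, translG_add]; exact mul_mem ha hb
      neg_mem' := fun {a} ha => by
        rw [Set.mem_ofPred_eq, translG_neg]; exact inv_mem ha }
  let U := AddSubgroup.toZModSubmodule q U₀
  have hU : ∀ w, w ∈ U ↔ translG c w ∈ L := fun w => Iff.rfl
  have hconj : ∀ (g : Gqp q p c) w, w ∈ U → g • w - g • (0 : Vqp q p) ∈ U := by
    intro g w hw
    rw [hU] at hw ⊢
    have hg : g ∈ L ⊔ translSub c := hL ▸ Subgroup.mem_top g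
    have heq : translG c (g • w - g • (0 : Vqp q p)) = g * translG c w * g⁻¹ := by
      rw [mul_translG hc, mul_inv_cancel_right]
    rw [heq]
    obtain ⟨l, hl, _, ⟨u, rfl⟩, rfl⟩ := Subgroup.mem_sup_of_normal_right.1 hg
    have : l * translG c u * translG c w * (l * translG c u)⁻¹ = l * translG c w * l⁻¹ := by
      rw [mul_assoc l, translG_mul_comm]; group
    rw [this]
    exact mul_mem (mul_mem hl hw) (inv_mem hl)
  obtain ⟨i, hi⟩ : ∃ i, v i ≠ 0 := by
    by_contra! h
    exact hv (funext h)
  have hsingle : (Pi.single i 1 : Vqp q p) ∈ U := by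
    have h1 := U.sub_mem (hconj (scaleG c i) v ((hU v).2 hvL)) ((hU v).2 hvL)
    have ha : ((c : ZMod q) - 1) * v i ≠ 0 := mul_ne_zero (sub_ne_zero.2 (coe_ne_one hc)) hi
    have h2 := U.smul_mem (((c : ZMod q) - 1) * v i)⁻¹ h1
    convert h2 using 1
    rw [scaleG_smul, scaleG_smul]
    funext j
    by_cases h : j = i
    · subst h
      simp only [Pi.smul_apply, Pi.sub_apply, Pi.add_apply, Pi.single_eq_same, Pi.zero_apply,
        smul_eq_mul]
      field_simp [sub_ne_zero.2 (coe_ne_one hc)]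
      ring
    · simp [h]
  have hall : ∀ j, (Pi.single j 1 : Vqp q p) ∈ U := by
    intro j
    refine forall_of_rot_stable (p := p) one_ne_zero
      (P := fun j => (Pi.single j 1 : Vqp q p) ∈ U) (fun k hk => ?_) hsingle j
    have h1 := hconj (rotG c) _ hk
    rw [rotG_smul_single] at h1
    have h0 : (rotG c : Gqp q p c) • (0 : Vqp q p) = 0 := by
      have h2 := rotG_smul_single (c := c) k 0
      rwa [Pi.single_zero, Pi.single_zero] at h2
    rwa [h0, sub_zero] at h1
  rw [← hL, left_eq_sup]
  rintro _ ⟨w, rfl⟩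
  rw [← hU, pi_eq_sum_univ' w]
  exact U.sum_mem fun j _ => U.smul_mem _ (by
    convert hall j using 1)

theorem isCoatom_stabilizer (w : Vqp q p) : IsCoatom (MulAction.stabilizer (Gqp q p c) w) := by
  refine ⟨stabilizer_ne_top w, fun L hL => ?_⟩
  obtain ⟨g, hgL, hg⟩ := SetLike.exists_of_lt hL
  rw [MulAction.mem_stabilizer_iff] at hg
  refine eq_top_of_translG_mem hc (v := -((g • w : Vqp q p) - w)) ?_
    (neg_ne_zero.2 (sub_ne_zero.2 hg)) ?_
  · rw [eq_top_iff, ← stabilizer_sup_translSub w]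
    exact sup_le_sup_right hL.le _
  · have h0 : (translG c (-((g • w : Vqp q p) - w)) * g) • w = w := by
      rw [mul_smul, translG_smul]
      abel
    have h := hL.le (MulAction.mem_stabilizer_iff.2 h0)
    simpa using mul_mem h (inv_mem hgL)

/-- A maximal subgroup not containing `V` is a point stabilizer. -/
theorem exists_eq_stabilizer {M : Subgroup (Gqp q p c)} (hM : IsCoatom M)
    (hT : ¬ translSub c ≤ M) : ∃ w : Vqp q p, M = MulAction.stabilizer (Gqp q p c) w := by
  have hsup : M ⊔ translSub c = ⊤ := hM.2 _ (left_lt_sup.2 hT)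
  have hpM : IsPGroup p M := by
    intro g
    refine ⟨2, ?_⟩
    obtain ⟨v, hv⟩ := pow_mem_translSub hc (g : Gqp q p c)
    by_cases h : v = 0
    · rw [h, translG_zero] at hv
      exact Subtype.ext hv.symm
    · refine absurd (eq_top_of_translG_mem hc hsup h ?_) hM.1
      rw [hv]
      exact pow_mem g.2 _
  have hpq : ¬ p ∣ Nat.card (Vqp q p) := by
    rw [Nat.card_fun, Nat.card_zmod]
    intro h
    have h1 := (Fact.out : p.Prime).dvd_of_dvd_pow h
    have h2 := (Nat.prime_dvd_prime_iff_eq Fact.out Fact.out).1 h1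
    have h3 : p ∣ q - 1 := by
      rw [← hc]; exact ZMod.orderOf_units_dvd_card_sub_one c
    have h4 := Nat.le_of_dvd (Nat.sub_pos_of_lt (Fact.out : q.Prime).one_lt) h3
    have := (Fact.out : q.Prime).two_le
    omega
  obtain ⟨w, hw⟩ := hpM.nonempty_fixed_point_of_prime_not_dvd_card (Vqp q p) hpq
  refine ⟨w, ?_⟩
  by_contra hne
  refine stabilizer_ne_top w (hM.2 _ (lt_of_le_of_ne ?_ hne))
  exact fun g hg => hw ⟨g, hg⟩

/-- A maximal subgroup containing `V` contains all diagonal elements whose exponents sum to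
zero. -/
theorem mem_of_isCoatom {M : Subgroup (Gqp q p c)} (hM : IsCoatom M) (hT : translSub c ≤ M)
    {g : Gqp q p c} (hs : shift hc g = 0) (he : ∑ i, expo hc g i = 0) : g ∈ M := by
  have := translSub_normal hc
  have hpow : ∀ g : Gqp q p c, g ^ p ^ 2 ∈ M := fun g => hT (pow_mem_translSub hc g)
  have hnormal : M.Normal := by
    have hpQ : IsPGroup p (Gqp q p c ⧸ translSub c) := by
      intro x
      obtain ⟨g, rfl⟩ := QuotientGroup.mk_surjective x
      exact ⟨2, (QuotientGroup.eq_one_iff _).2 (pow_mem_translSub hc g)⟩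
    have hnil := hpQ.isNilpotent
    have hcomap : (M.map (QuotientGroup.mk' (translSub c))).comap
        (QuotientGroup.mk' (translSub c)) = M := by
      rw [Subgroup.comap_map_eq, QuotientGroup.ker_mk', sup_eq_left.2 hT]
    have hco : IsCoatom (M.map (QuotientGroup.mk' (translSub c))) := by
      constructor
      · intro h
        rw [h, Subgroup.comap_top] at hcomap
        exact hM.1 hcomap.symm
      · intro L hL
        have h1 := hM.2 _ (hcomap ▸ (Subgroup.comap_lt_comap_of_surjective
          (QuotientGroup.mk'_surjective _)).2 hL)
        rw [← Subgroup.map_comap_eq_self_of_surjective (QuotientGroup.mk'_surjective _) L, h1]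
        exact Subgroup.map_top_of_surjective _ (QuotientGroup.mk'_surjective _)
    have := Subgroup.NormalizerCondition.normal_of_coatom _
      Group.normalizerCondition_of_isNilpotent hco
    rw [← hcomap]
    exact this.comap _
  have hpQ : IsPGroup p (Gqp q p c ⧸ M) := by
    intro x
    obtain ⟨g, rfl⟩ := QuotientGroup.mk_surjective x
    exact ⟨2, (QuotientGroup.eq_one_iff _).2 (hpow g)⟩
  have hcenter : Subgroup.center (Gqp q p c ⧸ M) = ⊤ := by
    have : Nontrivial (Gqp q p c ⧸ M) := QuotientGroup.nontrivial_iff.2 hM.1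
    have h1 : M < (Subgroup.center (Gqp q p c ⧸ M)).comap (QuotientGroup.mk' M) := by
      have h2 := (Subgroup.comap_lt_comap_of_surjective (QuotientGroup.mk'_surjective M)).2
        hpQ.bot_lt_center
      rwa [MonoidHom.comap_bot, QuotientGroup.ker_mk'] at h2
    rw [← Subgroup.map_comap_eq_self_of_surjective (QuotientGroup.mk'_surjective _)
      (Subgroup.center _), hM.2 _ h1]
    exact Subgroup.map_top_of_surjective _ (QuotientGroup.mk'_surjective _)
  let : CommGroup (Gqp q p c ⧸ M) := Group.commGroupOfCenterEqTop hcenter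
  exact (QuotientGroup.eq_one_iff g).1 (map_eq_one_of_sum_eq_zero hc (QuotientGroup.mk' M)
    (fun v => (QuotientGroup.eq_one_iff _).2 (hT (translG_mem v))) hs he)

end MaximalSubgroups

section GeneralPosition

variable {p q : ℕ} [Fact q.Prime] [Fact p.Prime] {c : (ZMod q)ˣ} (hc : orderOf c = p)

include hc

theorem apply_ne_of_shift_ne_zero {g : Gqp q p c} (hg : shift hc g ≠ 0) {x y : Vqp q p}
    (hx : g • x = x) (hy : g • y = y) (hxy : x ≠ y) (i : Fin p) : x i ≠ y i := by
  intro h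
  refine hxy (funext fun j => forall_of_rot_stable hg (P := fun j => x j = y j) ?_ h j)
  intro j hj
  have h1 := smul_eq hc g x (rot p (shift hc g) j)
  have h2 := smul_eq hc g y (rot p (shift hc g) j)
  rw [show (rot p (shift hc g))⁻¹ (rot p (shift hc g) j) = j from
    (rot p (shift hc g)).symm_apply_apply j] at h1 h2
  rw [hx] at h1
  rw [hy] at h2
  rw [h1, h2, hj]

theorem expo_apply_eq_zero {g : Gqp q p c} (hg : shift hc g = 0) {x y : Vqp q p}
    {i : Fin p} (hx : (g • x) i = x i) (hy : (g • y) i = y i) (hxy : x i ≠ y i) :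
    expo hc g i = 0 := by
  rw [smul_eq hc, hg, rot_zero, inv_one, Equiv.Perm.one_apply] at hx hy
  rw [← scal_eq_one hc, ← sub_eq_zero]
  refine (mul_eq_zero.1 ?_).resolve_right (sub_ne_zero.2 hxy)
  linear_combination hx - hy

theorem eq_one_of_expo_eq_zero {g : Gqp q p c} (hg : shift hc g = 0) (he : expo hc g = 0)
    {x : Vqp q p} (hx : g • x = x) : g = 1 := by
  obtain ⟨v, rfl⟩ := (mem_translSub hc).2 ⟨hg, he⟩
  rw [translG_smul, add_eq_right] at hx
  rw [hx, translG_zero]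

theorem mem_zpowers_of_smul_eq {g h : Gqp q p c} (hg : shift hc g ≠ 0) {x y : Vqp q p}
    (hxy : x ≠ y) (hgx : g • x = x) (hgy : g • y = y) (hhx : h • x = x) (hhy : h • y = y) :
    h ∈ Subgroup.zpowers g := by
  set r := (shift hc h * (shift hc g)⁻¹).val with hr
  have hpow : ∀ z : Vqp q p, g • z = z → h • z = z → (h * (g ^ r)⁻¹) • z = z := by
    intro z hgz hhz
    have h1 : h ∈ MulAction.stabilizer (Gqp q p c) z := hhz
    have h2 : g ∈ MulAction.stabilizer (Gqp q p c) z := hgz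
    exact mul_mem h1 (inv_mem (pow_mem h2 r))
  have hs : shift hc (h * (g ^ r)⁻¹) = 0 := by
    have h1 : shift hc (h * (g ^ r)⁻¹ * g ^ r) = shift hc h := by rw [inv_mul_cancel_right]
    rw [shift_mul, shift_pow, nsmul_eq_mul, hr, ZMod.natCast_zmod_val,
      inv_mul_cancel_right₀ hg, add_eq_right] at h1
    exact h1
  have he : expo hc (h * (g ^ r)⁻¹) = 0 := funext fun i =>
    expo_apply_eq_zero hc hs (congrFun (hpow x hgx hhx) i) (congrFun (hpow y hgy hhy) i)
      (apply_ne_of_shift_ne_zero hc hg hgx hgy hxy i)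
  have h1 := eq_one_of_expo_eq_zero hc hs he (hpow x hgx hhx)
  rw [mul_inv_eq_one] at h1
  rw [h1]
  exact pow_mem (Subgroup.mem_zpowers g) r

section Counting

variable {α β : Type*}

section Supplements

variable {N : β → Subgroup (Gqp q p c)}
  (hN : ∀ j g, shift hc g = 0 → ∑ i, expo hc g i = 0 → g ∈ N j) {h : β → Gqp q p c}
  (hh : ∀ i j, i ≠ j → h i ∈ N j) (hh' : ∀ i, h i ∉ N i)

include hN hh hh'

theorem card_le_two [Fintype β] : Fintype.card β ≤ 2 := by
  let φ : Gqp q p c →* Multiplicative (ZMod p × ZMod p) :=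
    MonoidHom.mk' (fun g => Multiplicative.ofAdd ((shiftHom hc g).toAdd, (sumHom hc g).toAdd))
      fun g g' => by rw [(shiftHom hc).map_mul, (sumHom hc).map_mul]; rfl
  have hφ : ∀ j, φ.ker ≤ N j := by
    intro j g hg
    have h1 : ((shiftHom hc g).toAdd, (sumHom hc g).toAdd) = 0 :=
      congrArg Multiplicative.toAdd (MonoidHom.mem_ker.1 hg)
    rw [Prod.mk_eq_zero] at h1
    exact hN j g h1.1 h1.2
  have h1 :=
    (linearIndependent_of_generalPosition (p := p) φ N hφ h hh hh').fintype_card_le_finrank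
  simpa using h1

theorem card_le_one_of_smul_eq [Fintype β] {x y : Vqp q p} (hxy : x ≠ y)
    (hx : ∀ j, h j • x = x) (hy : ∀ j, h j • y = y) : Fintype.card β ≤ 1 := by
  by_cases hs : ∀ j, shift hc (h j) = 0
  · let S : Subgroup (Gqp q p c) := (shiftHom hc).ker
    have h1 := (linearIndependent_of_generalPosition (p := p) (W := ZMod p)
      ((sumHom hc).comp S.subtype)
      (fun j => (N j).comap S.subtype)
      (fun j g hg => hN j g ((shiftHom_eq_one hc).1 g.2) ((sumHom_eq_one hc).1 hg))
      (fun j => ⟨h j, (shiftHom_eq_one hc).2 (hs j)⟩) hh hh').fintype_card_le_finrank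
    simpa using h1
  · push Not at hs
    obtain ⟨j₀, hj₀⟩ := hs
    have hmem : ∀ j, h j ∈ Subgroup.zpowers (h j₀) := fun j =>
      mem_zpowers_of_smul_eq hc hj₀ hxy (hx j₀) (hy j₀) (hx j) (hy j)
    have hone : ∀ g ∈ Subgroup.zpowers (h j₀), shift hc g = 0 → g = 1 := by
      intro g hg hsg
      have hfix : ∀ z : Vqp q p, h j₀ • z = z → g • z = z := fun z hz =>
        (Subgroup.zpowers_le (H := MulAction.stabilizer (Gqp q p c) z)).2 hz hg
      exact eq_one_of_expo_eq_zero hc hsg (funext fun i =>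
        expo_apply_eq_zero hc hsg (congrFun (hfix x (hx j₀)) i) (congrFun (hfix y (hy j₀)) i)
          (apply_ne_of_shift_ne_zero hc hj₀ (hx j₀) (hy j₀) hxy i)) (hfix x (hx j₀))
    let S := Subgroup.zpowers (h j₀)
    have h1 := (linearIndependent_of_generalPosition (p := p) (W := ZMod p)
      ((shiftHom hc).comp S.subtype)
      (fun j => (N j).comap S.subtype)
      (fun j g hg => by
        have := hone g g.2 ((shiftHom_eq_one hc).1 hg)
        rw [Subgroup.mem_comap, Subgroup.subtype_apply, this]
        exact one_mem _)
      (fun j => ⟨h j, hmem j⟩) hh hh').fintype_card_le_finrank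
    simpa using h1

end Supplements

section Points

variable {w : α → Vqp q p} {g : α → Gqp q p c} (hg : ∀ i j, i ≠ j → g i • w j = w j)
  (hg' : ∀ i, g i • w i ≠ w i)

include hg hg'

omit [Fact p.Prime] hc in
theorem points_injective : Function.Injective w := by
  intro i j hij
  by_contra hne
  exact hg' i (by rw [hij]; exact hg i j hne)

/-- If every `g i` is diagonal, then the points determine distinct coordinates `f i` such that
the point `w i` is the only one having its value at `f i`, the others being equal there. -/
theorem exists_injective_of_shift_eq_zero [Fintype α] (hα : 3 ≤ Fintype.card α)
    (hs : ∀ i, shift hc (g i) = 0) :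
    ∃ f : α → Fin p, Function.Injective f ∧ ∀ i j, i ≠ j → w i (f i) ≠ w j (f i) := by
  classical
  have hthird : ∀ i j : α, ∃ k, k ≠ i ∧ k ≠ j := by
    intro i j
    obtain ⟨k, hk⟩ := Finset.exists_mem_notMem_of_card_lt_card (s := {i, j}) (t := Finset.univ)
      (lt_of_le_of_lt Finset.card_le_two (by rw [Finset.card_univ]; omega))
    exact ⟨k, by simpa [not_or] using hk⟩
  have hcoord : ∀ i, ∃ l, (g i • w i) l ≠ w i l := fun i => by
    by_contra! h
    exact hg' i (funext h)
  choose f hf using hcoord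
  have hne : ∀ i j, i ≠ j → w i (f i) ≠ w j (f i) := by
    intro i j hij h
    apply hf i
    have h1 := congrFun (hg i j hij) (f i)
    rw [smul_eq hc, hs, rot_zero, inv_one, Equiv.Perm.one_apply, ← h] at h1
    rw [smul_eq hc, hs, rot_zero, inv_one, Equiv.Perm.one_apply, h1]
  have heq : ∀ i j k, i ≠ j → i ≠ k → w j (f i) = w k (f i) := by
    intro i j k hij hik
    by_contra h
    have he := expo_apply_eq_zero hc (hs i) (congrFun (hg i j hij) (f i))
      (congrFun (hg i k hik) (f i)) h
    have h1 := congrFun (hg i j hij) (f i)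
    apply hf i
    rw [smul_eq hc, he, scal_zero, one_mul, hs, rot_zero, inv_one, Equiv.Perm.one_apply] at h1 ⊢
    rw [add_eq_left] at h1 ⊢
    exact h1
  refine ⟨f, fun i j hij => ?_, hne⟩
  by_contra hij'
  obtain ⟨k, hki, hkj⟩ := hthird i j
  have h1 := heq i j k hij' hki.symm
  rw [hij] at h1
  exact hne j k hkj.symm h1

end Points

/-- A family consisting of point stabilizers and of subgroups containing all diagonal elements
with exponents of sum zero has at most `p` members when it is in general position. -/
theorem card_add_card_le [Fintype α] [Fintype β] (hp : 3 ≤ p) {w : α → Vqp q p}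
    {g : α → Gqp q p c} (hg : ∀ i j, i ≠ j → g i • w j = w j) (hg' : ∀ i, g i • w i ≠ w i)
    {N : β → Subgroup (Gqp q p c)}
    (hN : ∀ j g, shift hc g = 0 → ∑ i, expo hc g i = 0 → g ∈ N j) {h : β → Gqp q p c}
    (hh : ∀ i j, i ≠ j → h i ∈ N j) (hh' : ∀ i, h i ∉ N i) (hw : ∀ j i, h j • w i = w i) :
    Fintype.card α + Fintype.card β ≤ p := by
  classical
  have hinj := points_injective hg hg'
  have hβ := card_le_two hc hN hh hh'
  rcases le_or_gt (Fintype.card α) 1 with hα | hα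
  · omega
  have hβ1 : Fintype.card β ≤ 1 := by
    obtain ⟨i, j, hij⟩ := Fintype.one_lt_card_iff.1 hα
    exact card_le_one_of_smul_eq hc hN hh hh' (hinj.ne hij) (fun k => hw k i) fun k => hw k j
  rcases le_or_gt (Fintype.card α) 2 with hα2 | hα2
  · omega
  have hthird : ∀ i : α, ∃ j k, i ≠ j ∧ i ≠ k ∧ j ≠ k := by
    intro i
    have h1 : 1 < (Finset.univ.erase i).card := by
      rw [Finset.card_erase_of_mem (Finset.mem_univ i), Finset.card_univ]; omega
    obtain ⟨j, hj, k, hk, hjk⟩ := Finset.one_lt_card.1 h1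
    exact ⟨j, k, (Finset.ne_of_mem_erase hj).symm, (Finset.ne_of_mem_erase hk).symm, hjk⟩
  rcases isEmpty_or_nonempty β with hempty | ⟨⟨b⟩⟩
  · rw [Fintype.card_eq_zero (α := β), add_zero]
    rcases le_or_gt (Fintype.card α) 3 with hα3 | hα3
    · omega
    have hs : ∀ i, shift hc (g i) = 0 := by
      intro i
      by_contra hi
      obtain ⟨j, -, hij, -⟩ := hthird i
      have h1 : 1 < ((Finset.univ.erase i).erase j).card := by
        rw [Finset.card_erase_of_mem (Finset.mem_erase.2 ⟨hij.symm, Finset.mem_univ j⟩),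
          Finset.card_erase_of_mem (Finset.mem_univ i), Finset.card_univ]
        omega
      obtain ⟨k, hk, l, hl, hkl⟩ := Finset.one_lt_card.1 h1
      simp only [Finset.mem_erase, Finset.mem_univ, and_true] at hk hl
      have h2 := mem_zpowers_of_smul_eq hc hi (hinj.ne hkl) (hg i k hk.2.symm) (hg i l hl.2.symm)
        (hg j k hk.1.symm) (hg j l hl.1.symm)
      exact hg' j ((Subgroup.zpowers_le (H := MulAction.stabilizer (Gqp q p c) (w j))).2
        (hg i j hij) h2)
    obtain ⟨f, hf, -⟩ := exists_injective_of_shift_eq_zero hc hg hg' hα2 hs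
    simpa using Fintype.card_le_of_injective f hf
  · have hb : shift hc (h b) = 0 := by
      by_contra hb
      obtain ⟨i⟩ : Nonempty α := Fintype.card_pos_iff.1 (by omega)
      obtain ⟨j, k, hij, hik, hjk⟩ := hthird i
      have h2 := mem_zpowers_of_smul_eq hc hb (hinj.ne hjk) (hw b j) (hw b k)
        (hg i j hij) (hg i k hik)
      exact hg' i ((Subgroup.zpowers_le (H := MulAction.stabilizer (Gqp q p c) (w i))).2
        (hw b i) h2)
    obtain ⟨l, hl⟩ : ∃ l, expo hc (h b) l ≠ 0 := by
      by_contra! h0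
      exact hh' b (hN b _ hb (Finset.sum_eq_zero fun i _ => h0 i))
    have hagree : ∀ i j, w i l = w j l := by
      intro i j
      by_contra hij
      exact hl (expo_apply_eq_zero hc hb (congrFun (hw b i) l) (congrFun (hw b j) l) hij)
    have hs : ∀ i, shift hc (g i) = 0 := by
      intro i
      by_contra hi
      obtain ⟨j, k, hij, hik, hjk⟩ := hthird i
      exact apply_ne_of_shift_ne_zero hc hi (hg i j hij) (hg i k hik) (hinj.ne hjk) l (hagree j k)
    obtain ⟨f, hf, hne⟩ := exists_injective_of_shift_eq_zero hc hg hg' hα2 hs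
    have hlt := Fintype.card_lt_of_injective_of_notMem f hf (b := l) (by
      rintro ⟨i, rfl⟩
      obtain ⟨j, -, hij, -⟩ := hthird i
      exact hne i j hij (hagree i j))
    rw [Fintype.card_fin] at hlt
    omega

end Counting

/-- A family of maximal subgroups of `G` in general position has at most `p` members. -/
theorem le_of_generalPosition (hp : 3 ≤ p) {n : ℕ} {M : Fin n → Subgroup (Gqp q p c)}
    (hM : ∀ i, IsCoatom (M i)) (hgen : GeneralPosition M) : n ≤ p := by
  classical
  have hwit : ∀ i, ∃ x, (∀ j, i ≠ j → x ∈ M j) ∧ x ∉ M i := by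
    intro i
    obtain ⟨x, hx, hx'⟩ := SetLike.exists_of_lt (hgen i)
    simp only [Subgroup.mem_iInf, Set.mem_compl_iff, Set.mem_singleton_iff] at hx hx'
    have h1 : ∀ j, i ≠ j → x ∈ M j := fun j hj => hx j hj.symm
    refine ⟨x, h1, fun hxi => hx' fun j => ?_⟩
    by_cases hj : i = j
    · exact hj ▸ hxi
    · exact h1 j hj
  choose x hx hx' using hwit
  have hstab : ∀ i : {i // ¬ translSub c ≤ M i},
      ∃ w : Vqp q p, M i = MulAction.stabilizer (Gqp q p c) w :=
    fun i => exists_eq_stabilizer hc (hM i) i.2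
  choose w hw using hstab
  have key := card_add_card_le hc hp (α := {i // ¬ translSub c ≤ M i})
    (β := {i // translSub c ≤ M i}) (w := w) (g := fun i => x i) (N := fun j => M j)
    (h := fun j => x j)
    (fun i j hij => by
      have h1 := hx i j (Subtype.coe_ne_coe.2 hij)
      rwa [hw j, MulAction.mem_stabilizer_iff] at h1)
    (fun i => by
      have h1 := hx' i
      rwa [hw i, MulAction.mem_stabilizer_iff] at h1)
    (fun j g hs he => mem_of_isCoatom hc (hM j) j.2 hs he)
    (fun i j hij => hx i j (Subtype.coe_ne_coe.2 hij)) (fun i => hx' i)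
    (fun j i => by
      have h1 := hx j i (fun h => i.2 (h ▸ j.2))
      rwa [hw i, MulAction.mem_stabilizer_iff] at h1)
  rw [Fintype.card_subtype_compl, Fintype.card_fin] at key
  have := Fintype.card_subtype_le fun i => translSub c ≤ M i
  rw [Fintype.card_fin] at this
  omega

/-- The stabilizers of the vectors of the standard basis are in general position. -/
theorem exists_generalPosition :
    ∃ M : Fin p → Subgroup (Gqp q p c), (∀ i, IsCoatom (M i)) ∧ GeneralPosition M := by
  refine ⟨fun i => MulAction.stabilizer (Gqp q p c) (Pi.single i 1 : Vqp q p),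
    fun i => isCoatom_stabilizer hc _, fun i => ?_⟩
  refine lt_of_le_of_ne (le_iInf₂ fun j _ => iInf_le _ j) fun heq => ?_
  have hmem : scaleG c i ∈ ⨅ j ∈ ({i}ᶜ : Set (Fin p)),
      MulAction.stabilizer (Gqp q p c) (Pi.single j 1 : Vqp q p) := by
    simp only [Subgroup.mem_iInf, Set.mem_compl_iff, Set.mem_singleton_iff]
    intro j hj
    rw [MulAction.mem_stabilizer_iff, scaleG_smul, Pi.single_eq_of_ne (Ne.symm hj), mul_zero,
      Pi.single_zero, add_zero]
  rw [← heq, Subgroup.mem_iInf] at hmem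
  have h1 := hmem i
  rw [MulAction.mem_stabilizer_iff, scaleG_smul, add_eq_left, Pi.single_eq_zero_iff,
    Pi.single_eq_same, mul_one, sub_eq_zero] at h1
  exact coe_ne_one hc h1

end GeneralPosition

/-- Proposition 9: for `p` an odd prime, `md(G_{q,p}) = p`. -/
theorem md_Gqp_eq (p q : ℕ) [Fact p.Prime] [Fact q.Prime] (hpq : p ∣ q - 1) (hodd : Odd p)
    (c : (ZMod q)ˣ) (hc : orderOf c = p) :
    mdInv ↥(Gqp q p c) = p := by
  have hp : 3 ≤ p := by
    have h2 := (Fact.out : p.Prime).two_le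
    obtain ⟨k, hk⟩ := hodd
    omega
  refine IsGreatest.csSup_eq ⟨exists_generalPosition hc, ?_⟩
  rintro n ⟨M, hM, hgen⟩
  exact le_of_generalPosition hc hp hM hgen
end

section
/- Let q be a prime with 2 dividing q − 1, and let G_{q,2} = V ⋊ H be as defined with p = 2. Then md(G_{q,2}) = 3. -/
open Equiv in
/-- The signed affine permutation `x ↦ (v i + ε i • x (e i))_i` of `F_q^2`. -/
def signedAffine {q : ℕ} (e : Perm (Fin 2)) (ε : Fin 2 → ℤˣ) (v : Vqp q 2) : Perm (Vqp q 2) :=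
  Equiv.addLeft v * Equiv.piCongrRight (fun i => MulAction.toPerm (ε i)) * coordPerm q 2 e⁻¹

section SignedAffine

variable {q : ℕ}

open Equiv

@[simp]
theorem signedAffine_apply (e : Perm (Fin 2)) (ε : Fin 2 → ℤˣ) (v x : Vqp q 2) (i : Fin 2) :
    signedAffine e ε v x i = v i + ε i • x (e i) := rfl

theorem signedAffine_mul (e e' : Perm (Fin 2)) (ε ε' : Fin 2 → ℤˣ) (v v' : Vqp q 2) :
    signedAffine e ε v * signedAffine e' ε' v' =
      signedAffine (e' * e) (fun i => ε i * ε' (e i)) (fun i => v i + ε i • v' (e i)) := by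
  ext x i
  simp [smul_add, mul_smul, add_assoc]

theorem signedAffine_one : signedAffine 1 1 (0 : Vqp q 2) = 1 := by
  ext x i
  simp

theorem signedAffine_inv (e : Perm (Fin 2)) (ε : Fin 2 → ℤˣ) (v : Vqp q 2) :
    (signedAffine e ε v)⁻¹ =
      signedAffine e⁻¹ (fun i => ε (e⁻¹ i)) (fun i => -(ε (e⁻¹ i) • v (e⁻¹ i))) := by
  rw [eq_comm, eq_inv_iff_mul_eq_one]
  ext x i
  simp [smul_add, smul_smul]

theorem perm_fin_two (e : Perm (Fin 2)) : e = 1 ∨ e = swap 0 1 := by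
  revert e; decide

theorem signedAffine_injective (h2 : (2 : ZMod q) ≠ 0) {e e' : Perm (Fin 2)}
    {ε ε' : Fin 2 → ℤˣ} {v v' : Vqp q 2} (h : signedAffine e ε v = signedAffine e' ε' v') :
    e = e' ∧ ε = ε' ∧ v = v' := by
  have happ : ∀ (x : Vqp q 2) i, v i + ε i • x (e i) = v' i + ε' i • x (e' i) := fun x i => by
    simpa using congrFun (DFunLike.congr_fun h x) i
  have hv : v = v' := funext fun i => by simpa using happ 0 i
  subst hv
  have h1 : (1 : ZMod q) ≠ 0 := fun h => h2 (by linear_combination 2 * h)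
  have he : e = e' := by
    ext1 i
    by_contra hne
    have := happ (Pi.single (e i) 1) i
    rw [Pi.single_eq_same, Pi.single_eq_of_ne (Ne.symm hne)] at this
    rcases Int.units_eq_one_or (ε i) with hi | hi <;> simp [hi, h1] at this
  subst he
  refine ⟨rfl, funext fun i => ?_, rfl⟩
  have := happ 1 i
  rcases Int.units_eq_one_or (ε i) with hi | hi <;>
    rcases Int.units_eq_one_or (ε' i) with hi' | hi' <;> simp [hi, hi', Units.smul_def] at this ⊢
  · exact h2 (by linear_combination this)
  · exact h2 (by linear_combination -this)

set_option maxHeartbeats 4000000 in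
/-- A nonzero vector is fixed by at most one nontrivial signed permutation. -/
theorem signed_perm_eq_of_fixed [Fact q.Prime] (h2 : (2 : ZMod q) ≠ 0) {e e' : Perm (Fin 2)}
    {ε ε' : Fin 2 → ℤˣ} {d : Vqp q 2} (hd : d ≠ 0)
    (h : ∀ i, d i = ε i • d (e i)) (h' : ∀ i, d i = ε' i • d (e' i))
    (hne : ¬ (e = 1 ∧ ε = 1)) (hne' : ¬ (e' = 1 ∧ ε' = 1)) : e = e' ∧ ε = ε' := by
  have hd' : ¬ (d 0 = 0 ∧ d 1 = 0) := fun hh => hd (by ext i; fin_cases i <;> simp [hh])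
  have a0 := h 0
  have a1 := h 1
  have b0 := h' 0
  have b1 := h' 1
  simp only [funext_iff, Fin.forall_fin_two, Pi.one_apply] at *
  rcases perm_fin_two e with rfl | rfl <;> rcases perm_fin_two e' with rfl | rfl <;>
  rcases Int.units_eq_one_or (ε 0) with i0 | i0 <;>
  rcases Int.units_eq_one_or (ε 1) with i1 | i1 <;>
  rcases Int.units_eq_one_or (ε' 0) with j0 | j0 <;>
  rcases Int.units_eq_one_or (ε' 1) with j1 | j1 <;>
  simp [i0, i1, j0, j1, Units.smul_def] at a0 a1 b0 b1 hne hne' ⊢ <;>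
  grind

theorem signedAffine_mem [Fact q.Prime] (e : Perm (Fin 2)) (ε : Fin 2 → ℤˣ) (v : Vqp q 2) :
    signedAffine e ε v ∈ Gqp q 2 (-1) := by
  have hH : Hqp q 2 (-1) ≤ Gqp q 2 (-1) := le_sup_right
  have hs : ∀ i, scalePerm q 2 (-1) i ∈ Gqp q 2 (-1) := fun i =>
    hH (Subgroup.subset_closure (Or.inl ⟨i, rfl⟩))
  have hr : coordPerm q 2 (finRotate 2) ∈ Gqp q 2 (-1) :=
    hH (Subgroup.subset_closure (Or.inr rfl))
  refine mul_mem (mul_mem ?_ ?_) ?_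
  · exact (le_sup_left : Vtrans q 2 ≤ _) (Subgroup.subset_closure ⟨v, rfl⟩)
  · rcases Int.units_eq_one_or (ε 0) with i0 | i0 <;>
    rcases Int.units_eq_one_or (ε 1) with i1 | i1
    · convert one_mem (Gqp q 2 (-1))
      ext x i
      fin_cases i <;> simp [i0, i1]
    · convert hs 1
      ext x i
      fin_cases i <;> simp [i0, i1, scalePerm, Units.smul_def]
    · convert hs 0
      ext x i
      fin_cases i <;> simp [i0, i1, scalePerm, Units.smul_def]
    · convert mul_mem (hs 0) (hs 1)
      ext x i
      fin_cases i <;> simp [i0, i1, scalePerm, Units.smul_def]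
  · rcases perm_fin_two e with rfl | rfl
    · exact one_mem _
    · convert hr using 2
      decide

theorem exists_eq_signedAffine [Fact q.Prime] {g : Perm (Vqp q 2)} (hg : g ∈ Gqp q 2 (-1)) :
    ∃ e ε v, g = signedAffine e ε v := by
  let S : Subgroup (Perm (Vqp q 2)) :=
    { carrier := {g | ∃ e ε v, g = signedAffine e ε v}
      mul_mem' := by
        rintro _ _ ⟨e, ε, v, rfl⟩ ⟨e', ε', v', rfl⟩
        exact ⟨_, _, _, signedAffine_mul ..⟩
      one_mem' := ⟨_, _, _, signedAffine_one.symm⟩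
      inv_mem' := by
        rintro _ ⟨e, ε, v, rfl⟩
        exact ⟨_, _, _, signedAffine_inv ..⟩ }
  suffices Gqp q 2 (-1) ≤ S from this hg
  refine sup_le ((Subgroup.closure_le _).2 ?_) ((Subgroup.closure_le _).2 ?_)
  · rintro _ ⟨v, rfl⟩
    refine ⟨1, 1, v, ?_⟩
    ext x i
    simp
  · rintro _ (⟨j, rfl⟩ | rfl)
    · refine ⟨1, Pi.mulSingle j (-1), 0, ?_⟩
      ext x i
      fin_cases i <;> fin_cases j <;> simp [scalePerm, Units.smul_def]
    · refine ⟨(finRotate 2)⁻¹, 1, 0, ?_⟩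
      ext x i
      simp [coordPerm]

/-- The signed affine permutations as elements of `G_{q,2}`. -/
def toGq2 [Fact q.Prime] (e : Perm (Fin 2)) (ε : Fin 2 → ℤˣ) (v : Vqp q 2) : Gqp q 2 (-1) :=
  ⟨signedAffine e ε v, signedAffine_mem e ε v⟩

end SignedAffine

section Gq2

variable {q : ℕ} [Fact q.Prime]

open Equiv

theorem toGq2_apply (e : Perm (Fin 2)) (ε : Fin 2 → ℤˣ) (v x : Vqp q 2) (i : Fin 2) :
    (toGq2 e ε v).1 x i = v i + ε i • x (e i) := rfl

theorem toGq2_mul (e e' : Perm (Fin 2)) (ε ε' : Fin 2 → ℤˣ) (v v' : Vqp q 2) :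
    toGq2 e ε v * toGq2 e' ε' v' =
      toGq2 (e' * e) (fun i => ε i * ε' (e i)) (fun i => v i + ε i • v' (e i)) :=
  Subtype.ext (signedAffine_mul ..)

theorem exists_eq_toGq2 (g : Gqp q 2 (-1)) : ∃ e ε v, g = toGq2 e ε v := by
  obtain ⟨e, ε, v, h⟩ := exists_eq_signedAffine g.2
  exact ⟨e, ε, v, Subtype.ext h⟩

theorem toGq2_injective (h2 : (2 : ZMod q) ≠ 0) {e e' : Perm (Fin 2)} {ε ε' : Fin 2 → ℤˣ}
    {v v' : Vqp q 2} (h : toGq2 e ε v = toGq2 e' ε' v') : e = e' ∧ ε = ε' ∧ v = v' :=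
  signedAffine_injective h2 (congrArg Subtype.val h)

theorem toGq2_one : toGq2 1 1 (0 : Vqp q 2) = 1 := Subtype.ext signedAffine_one

theorem trans_mul_toGq2 (e : Perm (Fin 2)) (ε : Fin 2 → ℤˣ) (u v : Vqp q 2) :
    toGq2 1 1 u * toGq2 e ε v = toGq2 e ε (u + v) := by
  rw [toGq2_mul]
  congr 1 <;> ext i <;> simp

theorem toGq2_mul_trans (e : Perm (Fin 2)) (ε : Fin 2 → ℤˣ) (u v : Vqp q 2) :
    toGq2 e ε v * toGq2 1 1 u = toGq2 1 1 (fun i => ε i • u (e i)) * toGq2 e ε v := by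
  rw [trans_mul_toGq2, toGq2_mul]
  congr 1 <;> ext i <;> simp [add_comm]

variable (q) in
/-- The subgroup of translations in `G_{q,2}`. -/
def transGq2 : Subgroup (Gqp q 2 (-1)) where
  carrier := {g | ∃ v, g = toGq2 1 1 v}
  mul_mem' := by
    rintro _ _ ⟨u, rfl⟩ ⟨v, rfl⟩
    exact ⟨u + v, trans_mul_toGq2 ..⟩
  one_mem' := ⟨0, toGq2_one.symm⟩
  inv_mem' := by
    rintro _ ⟨u, rfl⟩
    refine ⟨-u, inv_eq_of_mul_eq_one_left ?_⟩
    rw [trans_mul_toGq2, neg_add_cancel, toGq2_one]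

instance : (transGq2 q).Normal where
  conj_mem := by
    rintro _ ⟨u, rfl⟩ g
    obtain ⟨e, ε, v, rfl⟩ := exists_eq_toGq2 g
    exact ⟨_, by rw [toGq2_mul_trans, mul_inv_cancel_right]⟩

/-- The coordinate permutation and the product of the signs of an element of `G_{q,2}`. -/
noncomputable def signClassFun (g : Gqp q 2 (-1)) : Perm (Fin 2) × ℤˣ :=
  ((exists_eq_toGq2 g).choose, ∏ i, (exists_eq_toGq2 g).choose_spec.choose i)

theorem signClassFun_toGq2 (h2 : (2 : ZMod q) ≠ 0) (e : Perm (Fin 2)) (ε : Fin 2 → ℤˣ)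
    (v : Vqp q 2) : signClassFun (toGq2 e ε v) = (e, ∏ i, ε i) := by
  have h := (exists_eq_toGq2 (toGq2 e ε v)).choose_spec.choose_spec.choose_spec
  obtain ⟨h1, h3, -⟩ := toGq2_injective h2 h
  exact Prod.ext h1.symm (Fintype.prod_congr _ _ fun i => (congrFun h3 i).symm)

variable (q) in
/-- The quotient map of `G_{q,2}` recording the coordinate permutation and the product of the
signs. -/
noncomputable def signClass (h2 : (2 : ZMod q) ≠ 0) : Gqp q 2 (-1) →* Perm (Fin 2) × ℤˣ :=
  MonoidHom.mk' signClassFun <| by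
    intro g h
    obtain ⟨e, ε, v, rfl⟩ := exists_eq_toGq2 g
    obtain ⟨e', ε', v', rfl⟩ := exists_eq_toGq2 h
    rw [toGq2_mul]
    simp only [signClassFun_toGq2 h2]
    ext1
    · change e' * e = e * e'
      revert e e'; decide
    · simp [Finset.prod_mul_distrib, Equiv.prod_comp]

theorem signClass_toGq2 (h2 : (2 : ZMod q) ≠ 0) (e : Perm (Fin 2)) (ε : Fin 2 → ℤˣ)
    (v : Vqp q 2) : signClass q h2 (toGq2 e ε v) = (e, ∏ i, ε i) :=
  signClassFun_toGq2 h2 e ε v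

/-- The group `H` acts irreducibly on `V`: a subgroup covering `H` and containing a nontrivial
translation contains all translations. -/
theorem trans_mem_of_ne_zero (h2 : (2 : ZMod q) ≠ 0) {B : Subgroup (Gqp q 2 (-1))}
    (hB : ∀ e ε, ∃ v, toGq2 e ε v ∈ B) {v : Vqp q 2} (hv : v ≠ 0) (hvB : toGq2 1 1 v ∈ B)
    (u : Vqp q 2) : toGq2 1 1 u ∈ B := by
  let N : AddSubgroup (Vqp q 2) :=
    { carrier := {v | toGq2 1 1 v ∈ B}
      add_mem' := by
        intro a b ha hb
        change toGq2 1 1 (a + b) ∈ B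
        rw [← trans_mul_toGq2]
        exact B.mul_mem ha hb
      zero_mem' := by
        change toGq2 1 1 0 ∈ B
        rw [toGq2_one]
        exact B.one_mem
      neg_mem' := by
        intro a ha
        have : toGq2 1 1 (-a) = (toGq2 1 1 a)⁻¹ := by
          rw [eq_inv_iff_mul_eq_one, trans_mul_toGq2, neg_add_cancel, toGq2_one]
        change toGq2 1 1 (-a) ∈ B
        rw [this]
        exact B.inv_mem ha }
  have hN : ∀ (e : Perm (Fin 2)) (ε : Fin 2 → ℤˣ), ∀ a ∈ N, (fun i => ε i • a (e i)) ∈ N := by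
    intro e ε a ha
    obtain ⟨w, hw⟩ := hB e ε
    have h := mul_mem (mul_mem hw ha) (inv_mem hw)
    rwa [toGq2_mul_trans, mul_inv_cancel_right] at h
  have hsw : ∀ a b : ZMod q, ![a, b] ∈ N → ![b, a] ∈ N := fun a b hab => by
    convert hN (swap 0 1) 1 _ hab using 1
    ext i; fin_cases i <;> simp
  have key : ∀ a b : ZMod q, a ≠ 0 → ![a, b] ∈ N → ∀ y, ![y, 0] ∈ N := by
    intro a b ha hab y
    have h1 : ![2 * a, 0] ∈ N := by
      convert add_mem hab (hN 1 ![1, -1] _ hab) using 1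
      ext i; fin_cases i <;> simp [Units.smul_def, two_mul]
    convert nsmul_mem h1 (y / (2 * a)).val using 1
    ext i; fin_cases i
    · simp [h2, ha]
    · simp
  have hall : ∀ y, ![y, 0] ∈ N := by
    have hvN : ![v 0, v 1] ∈ N := by
      convert (show v ∈ N from hvB) using 1
      ext i; fin_cases i <;> rfl
    by_cases h0 : v 0 = 0
    · refine key (v 1) (v 0) (fun h1 => hv ?_) (hsw _ _ hvN)
      ext i; fin_cases i <;> simp [h0, h1]
    · exact key _ _ h0 hvN
  have : u = ![u 0, 0] + ![0, u 1] := by ext i; fin_cases i <;> simp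
  rw [this]
  exact add_mem (hall _) (hsw _ _ (hall _))

theorem eq_top_of_trans_mem {B : Subgroup (Gqp q 2 (-1))}
    (hB : ∀ e ε, ∃ v, toGq2 e ε v ∈ B) (hT : ∀ u, toGq2 1 1 u ∈ B) : B = ⊤ := by
  refine (Subgroup.eq_top_iff' _).2 fun g => ?_
  obtain ⟨e, ε, v, rfl⟩ := exists_eq_toGq2 g
  obtain ⟨w, hw⟩ := hB e ε
  simpa [trans_mul_toGq2] using mul_mem (hT (v - w)) hw

/-- The stabilizer of the point `x` in `G_{q,2}`. -/
def pointStab (x : Vqp q 2) : Subgroup (Gqp q 2 (-1)) := MulAction.stabilizer _ x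

theorem mem_pointStab {x : Vqp q 2} {g : Gqp q 2 (-1)} : g ∈ pointStab x ↔ g.1 x = x := Iff.rfl

theorem pointStab_ne_top (x : Vqp q 2) : pointStab x ≠ ⊤ := by
  intro h
  have h1 := congrFun (mem_pointStab.1 (h ▸ Subgroup.mem_top (toGq2 1 1 1) :
    toGq2 1 1 1 ∈ pointStab x)) 0
  simp [toGq2_apply] at h1

theorem isCoatom_pointStab_zero (h2 : (2 : ZMod q) ≠ 0) :
    IsCoatom (pointStab (0 : Vqp q 2)) := by
  refine ⟨pointStab_ne_top 0, fun B hB => ?_⟩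
  have hlin : ∀ e ε, toGq2 e ε 0 ∈ B := fun e ε =>
    hB.le (mem_pointStab.2 (by ext i; simp [toGq2_apply]))
  obtain ⟨g, hgB, hg⟩ := Set.exists_of_ssubset hB
  obtain ⟨e, ε, v, rfl⟩ := exists_eq_toGq2 g
  have hv : v ≠ 0 := by
    rintro rfl
    exact hg (mem_pointStab.2 (by ext i; simp [toGq2_apply]))
  have hvB : toGq2 1 1 v ∈ B := by
    refine (Subgroup.mul_mem_cancel_right B (hlin e ε)).1 ?_
    rwa [trans_mul_toGq2, add_zero]
  exact eq_top_of_trans_mem (fun e ε => ⟨0, hlin e ε⟩)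
    (trans_mem_of_ne_zero h2 (fun e ε => ⟨0, hlin e ε⟩) hv hvB)

/-- A maximal subgroup of `G_{q,2}` contains all translations or is a point stabilizer. -/
theorem transGq2_le_or_eq_pointStab (h2 : (2 : ZMod q) ≠ 0) {M : Subgroup (Gqp q 2 (-1))}
    (hM : IsCoatom M) : transGq2 q ≤ M ∨ ∃ x, M = pointStab x := by
  by_cases hT : transGq2 q ≤ M
  · exact Or.inl hT
  right
  have htop : M ⊔ transGq2 q = ⊤ := hM.2 _ (left_lt_sup.2 hT)
  have hlin : ∀ e ε, ∃ v, toGq2 e ε v ∈ M := by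
    intro e ε
    have hmem : toGq2 e ε 0 ∈ M ⊔ transGq2 q := htop ▸ Subgroup.mem_top _
    rw [sup_comm] at hmem
    obtain ⟨_, ⟨u, rfl⟩, m, hm, hmt⟩ := Subgroup.mem_sup_of_normal_left.1 hmem
    refine ⟨-u, ?_⟩
    rw [← add_zero (-u), ← trans_mul_toGq2, ← hmt, ← mul_assoc, trans_mul_toGq2, neg_add_cancel,
      toGq2_one, one_mul]
    exact hm
  have hzero : ∀ v, toGq2 1 1 v ∈ M → v = 0 := by
    intro v hv
    by_contra h0
    refine hT ?_
    rintro _ ⟨u, rfl⟩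
    exact trans_mem_of_ne_zero h2 hlin h0 hv u
  obtain ⟨w, hw⟩ := hlin 1 (-1)
  refine ⟨fun i => w i / 2, ?_⟩
  have hle : M ≤ pointStab (fun i => w i / 2) := by
    intro m hm
    obtain ⟨e, ε, v, rfl⟩ := exists_eq_toGq2 m
    have hcomm : toGq2 e ε v * toGq2 1 (-1) w =
        toGq2 1 1 (fun i => ε i • w (e i) + 2 * v i - w i) *
          (toGq2 1 (-1) w * toGq2 e ε v) := by
      rw [toGq2_mul, toGq2_mul, trans_mul_toGq2]
      congr 1
      · ext i; simp
      · ext i; simp [Units.smul_def]; ring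
    have h0 := hzero _ ((Subgroup.mul_mem_cancel_right M (mul_mem hw hm)).1
      (hcomm ▸ mul_mem hm hw))
    refine mem_pointStab.2 (funext fun i => ?_)
    have hi := congrFun h0 i
    rw [toGq2_apply]
    simp only [Units.smul_def, zsmul_eq_mul, Pi.zero_apply] at hi ⊢
    field_simp
    linear_combination hi
  exact (hM.le_iff_eq (pointStab_ne_top _)).1 hle |>.symm

/-- A maximal subgroup containing all translations contains the preimage of the Frattini
subgroup of `H`. -/
theorem ker_signClass_le (h2 : (2 : ZMod q) ≠ 0) {M : Subgroup (Gqp q 2 (-1))}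
    (hM : IsCoatom M) (hT : transGq2 q ≤ M) : (signClass q h2).ker ≤ M := by
  by_contra hK
  have htop : M ⊔ (signClass q h2).ker = ⊤ := hM.2 _ (left_lt_sup.2 hK)
  have hlift : ∀ g, ∃ m ∈ M, signClass q h2 m = signClass q h2 g := by
    intro g
    have hmem : g ∈ M ⊔ (signClass q h2).ker := htop ▸ Subgroup.mem_top _
    obtain ⟨m, hm, k, hk, rfl⟩ := Subgroup.mem_sup_of_normal_right.1 hmem
    exact ⟨m, hm, by rw [map_mul, MonoidHom.mem_ker.1 hk, mul_one]⟩
  obtain ⟨a, ha, ha'⟩ := hlift (toGq2 1 ![1, -1] 0)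
  obtain ⟨s, hs, hs'⟩ := hlift (toGq2 (swap 0 1) 1 0)
  obtain ⟨e, ε, v, rfl⟩ := exists_eq_toGq2 a
  obtain ⟨e', ε', v', rfl⟩ := exists_eq_toGq2 s
  simp only [signClass_toGq2, Prod.mk.injEq, Fin.prod_univ_two] at ha' hs'
  obtain ⟨rfl, ha'⟩ := ha'
  obtain ⟨rfl, hs'⟩ := hs'
  have hneg : ∃ w, toGq2 1 (-1) w ∈ M := by
    have h := mul_mem (mul_mem ha hs) (mul_mem ha hs)
    rw [toGq2_mul, toGq2_mul] at h
    have he : swap (0 : Fin 2) 1 * 1 * (swap 0 1 * 1) = 1 := by simp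
    have hε : (fun i => ε i * ε' ((1 : Perm (Fin 2)) i) *
        (ε ((swap 0 1 * 1 : Perm (Fin 2)) i) *
          ε' ((1 : Perm (Fin 2)) ((swap 0 1 * 1 : Perm (Fin 2)) i)))) = -1 := by
      ext i
      revert ha' hs'
      rcases Int.units_eq_one_or (ε 0) with i0 | i0 <;>
      rcases Int.units_eq_one_or (ε 1) with i1 | i1 <;>
      rcases Int.units_eq_one_or (ε' 0) with j0 | j0 <;>
      rcases Int.units_eq_one_or (ε' 1) with j1 | j1 <;>
      fin_cases i <;> simp [i0, i1, j0, j1]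
    rw [he, hε] at h
    exact ⟨_, h⟩
  obtain ⟨w, hw⟩ := hneg
  refine hK fun k hk => ?_
  obtain ⟨e, ε, u, rfl⟩ := exists_eq_toGq2 k
  rw [MonoidHom.mem_ker, signClass_toGq2, Prod.mk_eq_one, Fin.prod_univ_two] at hk
  obtain ⟨rfl, hk⟩ := hk
  have hε : ε = 1 ∨ ε = -1 := by
    simp only [funext_iff, Fin.forall_fin_two]
    rcases Int.units_eq_one_or (ε 0) with i0 | i0 <;>
    rcases Int.units_eq_one_or (ε 1) with i1 | i1 <;> simp [i0, i1] at hk ⊢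
  rcases hε with rfl | rfl
  · exact hT ⟨u, rfl⟩
  · simpa [trans_mul_toGq2] using mul_mem (hT ⟨u - w, rfl⟩) hw

theorem eq_of_fixes_two_points (h2 : (2 : ZMod q) ≠ 0) {x y : Vqp q 2} (hxy : x ≠ y)
    {g h : Gqp q 2 (-1)} (hg : g ≠ 1) (hh : h ≠ 1) (hgx : g ∈ pointStab x)
    (hgy : g ∈ pointStab y) (hhx : h ∈ pointStab x) (hhy : h ∈ pointStab y) : g = h := by
  obtain ⟨e, ε, v, rfl⟩ := exists_eq_toGq2 g
  obtain ⟨e', ε', v', rfl⟩ := exists_eq_toGq2 h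
  simp only [mem_pointStab, funext_iff, toGq2_apply] at hgx hgy hhx hhy
  have hne : ∀ {e ε} {v : Vqp q 2}, toGq2 e ε v ≠ 1 → (∀ i, v i + ε i • x (e i) = x i) →
      ¬ (e = 1 ∧ ε = 1) := by
    rintro _ _ v h1 h3 ⟨rfl, rfl⟩
    have : v = 0 := funext fun i => by simpa using h3 i
    exact h1 (this ▸ toGq2_one)
  obtain ⟨rfl, rfl⟩ := signed_perm_eq_of_fixed h2 (sub_ne_zero.2 hxy) (e := e) (ε := ε)
    (e' := e') (ε' := ε')
    (fun i => by
      simp only [Pi.sub_apply, smul_sub]; linear_combination hgy i - hgx i)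
    (fun i => by
      simp only [Pi.sub_apply, smul_sub]; linear_combination hhy i - hhx i)
    (hne hg hgx) (hne hh hhx)
  congr 1
  ext i
  linear_combination hgx i - hhx i

end Gq2

section GeneralPosition

variable {G : Type*} [Group G]

theorem generalPosition_iff {ι : Type*} {M : ι → Subgroup G} :
    GeneralPosition M ↔ ∀ i, ∃ g, g ∉ M i ∧ ∀ j ≠ i, g ∈ M j := by
  refine forall_congr' fun i => ⟨fun h => ?_, ?_⟩
  · obtain ⟨g, hg, hg'⟩ := Set.exists_of_ssubset h
    have hgj : ∀ j ≠ i, g ∈ M j := by simpa [Subgroup.mem_iInf] using hg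
    refine ⟨g, fun hi => hg' (Subgroup.mem_iInf.2 fun j => ?_), hgj⟩
    by_cases hj : j = i
    · exact hj ▸ hi
    · exact hgj j hj
  · rintro ⟨g, hi, hj⟩
    refine lt_of_le_of_ne (le_iInf₂ fun j _ => iInf_le _ _) fun h => hi ?_
    have : g ∈ ⨅ j ∈ ({i}ᶜ : Set ι), M j := by simpa [Subgroup.mem_iInf] using hj
    exact Subgroup.mem_iInf.1 (h ▸ this) i

theorem isCoatom_ker_of_forall_mul_eq_one {X : Type*} [Group X] (φ : G →* X) {g₀ : G}
    (hg₀ : φ g₀ ≠ 1) (hX : ∀ a b : X, a ≠ 1 → b ≠ 1 → a * b = 1) : IsCoatom φ.ker := by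
  refine ⟨fun h => hg₀ (MonoidHom.mem_ker.1 (h ▸ Subgroup.mem_top g₀)), fun B hB => ?_⟩
  obtain ⟨b, hbB, hb⟩ := Set.exists_of_ssubset hB
  refine (Subgroup.eq_top_iff' _).2 fun g => ?_
  by_cases hg : φ g = 1
  · exact hB.le hg
  · refine (Subgroup.mul_mem_cancel_right B hbB).1 (hB.le ?_)
    rw [MonoidHom.mem_ker, map_mul, hX _ _ hg hb]

end GeneralPosition

section MaximalDimension

variable {q : ℕ} [Fact q.Prime]

open Equiv

theorem exists_three_generalPosition (h2 : (2 : ZMod q) ≠ 0) :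
    ∃ M : Fin 3 → Subgroup (Gqp q 2 (-1)), (∀ i, IsCoatom (M i)) ∧ GeneralPosition M := by
  refine ⟨![pointStab 0, ((MonoidHom.fst _ _).comp (signClass q h2)).ker,
    ((MonoidHom.snd _ _).comp (signClass q h2)).ker], ?_, ?_⟩
  · intro i
    fin_cases i
    · exact isCoatom_pointStab_zero h2
    · refine isCoatom_ker_of_forall_mul_eq_one _ (g₀ := toGq2 (swap 0 1) 1 0) ?_ (by decide)
      simp [signClass_toGq2]
    · refine isCoatom_ker_of_forall_mul_eq_one _ (g₀ := toGq2 1 ![1, -1] 0) ?_ (by decide)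
      simp [signClass_toGq2]
  · refine generalPosition_iff.2 fun i => ?_
    fin_cases i
    · refine ⟨toGq2 1 1 1, ?_, ?_⟩
      · simp [mem_pointStab, funext_iff, toGq2_apply]
      · simp [Fin.forall_fin_succ, signClass_toGq2, MonoidHom.mem_ker]
    · refine ⟨toGq2 (swap 0 1) 1 0, ?_, ?_⟩
      · simp [signClass_toGq2, MonoidHom.mem_ker]
      · simp [Fin.forall_fin_succ, signClass_toGq2, MonoidHom.mem_ker, mem_pointStab, funext_iff,
          toGq2_apply]
    · refine ⟨toGq2 1 ![1, -1] 0, ?_, ?_⟩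
      · simp [signClass_toGq2, MonoidHom.mem_ker]
      · simp [Fin.forall_fin_succ, signClass_toGq2, MonoidHom.mem_ker, mem_pointStab, funext_iff,
          toGq2_apply]

set_option synthInstance.maxSize 2000 in
set_option synthInstance.maxHeartbeats 400000 in
/-- Three subgroups containing the kernel of `signClass` are not in general position. -/
theorem not_three_of_ker_signClass_le (h2 : (2 : ZMod q) ≠ 0)
    {M₁ M₂ M₃ : Subgroup (Gqp q 2 (-1))}
    (h₁ : (signClass q h2).ker ≤ M₁) (h₂ : (signClass q h2).ker ≤ M₂)
    (h₃ : (signClass q h2).ker ≤ M₃) {g₁ g₂ g₃ : Gqp q 2 (-1)}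
    (h₁₁ : g₁ ∉ M₁) (h₁₃ : g₁ ∈ M₃) (h₂₁ : g₂ ∈ M₁) (h₂₂ : g₂ ∉ M₂)
    (h₂₃ : g₂ ∈ M₃) (h₃₁ : g₃ ∈ M₁) (h₃₂ : g₃ ∈ M₂) (h₃₃ : g₃ ∉ M₃) : False := by
  have hX : ∀ a b c : Perm (Fin 2) × ℤˣ, a ≠ 1 → b ≠ 1 → c ≠ 1 → a ≠ b → a ≠ c → b ≠ c →
      a * b * c = 1 := by decide
  have hsq : ∀ a : Perm (Fin 2) × ℤˣ, a * a = 1 := by decide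
  have hne : ∀ {M : Subgroup (Gqp q 2 (-1))} {g g'}, (signClass q h2).ker ≤ M → g ∉ M → g' ∈ M →
      signClass q h2 g ≠ signClass q h2 g' := by
    intro M g g' hM hg hg' h
    refine hg ((Subgroup.mul_mem_cancel_right M hg').1 (hM ?_))
    rw [MonoidHom.mem_ker, map_mul, h, hsq]
  have hone : ∀ {M : Subgroup (Gqp q 2 (-1))} {g}, (signClass q h2).ker ≤ M → g ∉ M →
      signClass q h2 g ≠ 1 := fun hM hg h => hg (hM h)
  have h := hX _ _ _ (hone h₁ h₁₁) (hone h₂ h₂₂) (hone h₃ h₃₃) (hne h₁ h₁₁ h₂₁)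
    (hne h₁ h₁₁ h₃₁) (hne h₂ h₂₂ h₃₂)
  rw [← map_mul, ← map_mul] at h
  exact h₃₃ ((Subgroup.mul_mem_cancel_left M₃ (mul_mem h₁₃ h₂₃)).1 (h₃ h))

theorem not_generalPosition_four (h2 : (2 : ZMod q) ≠ 0) (M : Fin 4 → Subgroup (Gqp q 2 (-1)))
    (hM : ∀ i, IsCoatom (M i)) : ¬ GeneralPosition M := by
  intro hgp
  choose g hgi hgj using generalPosition_iff.1 hgp
  by_cases hp : ∃ i j, i ≠ j ∧ (∃ x, M i = pointStab x) ∧ ∃ y, M j = pointStab y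
  · obtain ⟨i, j, hij, ⟨x, hx⟩, ⟨y, hy⟩⟩ := hp
    have hkl : ∀ i j : Fin 4, i ≠ j → ∃ k l, k ≠ l ∧ i ≠ k ∧ i ≠ l ∧ j ≠ k ∧ j ≠ l := by decide
    obtain ⟨k, l, hkl, hik, hil, hjk, hjl⟩ := hkl i j hij
    have hxy : x ≠ y := by
      rintro rfl
      exact hgi i (hx ▸ hy ▸ hgj i j hij.symm)
    have hne : ∀ i, g i ≠ 1 := fun i h => hgi i (h ▸ one_mem _)
    have := eq_of_fixes_two_points h2 hxy (hne k) (hne l) (hx ▸ hgj k i hik) (hy ▸ hgj k j hjk)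
      (hx ▸ hgj l i hil) (hy ▸ hgj l j hjl)
    exact hgi k (this ▸ hgj l k hkl)
  · have hN : ∃ i, ∀ j ≠ i, ¬ ∃ x, M j = pointStab x := by
      by_cases h : ∃ i x, M i = pointStab x
      · obtain ⟨i, hi⟩ := h
        exact ⟨i, fun j hj hx => hp ⟨i, j, hj.symm, hi, hx⟩⟩
      · exact ⟨0, fun j _ hx => h ⟨j, hx⟩⟩
    obtain ⟨i, hi⟩ := hN
    have hK : ∀ j ≠ i, (signClass q h2).ker ≤ M j := fun j hj =>
      ker_signClass_le h2 (hM j)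
        ((transGq2_le_or_eq_pointStab h2 (hM j)).resolve_right (hi j hj))
    have hjkl : ∀ i : Fin 4, ∃ j k l, j ≠ i ∧ k ≠ i ∧ l ≠ i ∧ j ≠ k ∧ j ≠ l ∧ k ≠ l := by decide
    obtain ⟨j, k, l, hj, hk, hl, hjk, hjl, hkl⟩ := hjkl i
    exact not_three_of_ker_signClass_le h2 (hK j hj) (hK k hk) (hK l hl) (hgi j)
      (hgj j l hjl.symm) (hgj k j hjk) (hgi k) (hgj k l hkl.symm)
      (hgj l j hjl) (hgj l k hkl) (hgi l)

end MaximalDimension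

/-- Proposition 10: `md(G_{q,2}) = 3`. -/
theorem md_Gq2_eq_three (q : ℕ) [Fact q.Prime] (hq : 2 ∣ q - 1)
    (c : (ZMod q)ˣ) (hc : orderOf c = 2) :
    mdInv ↥(Gqp q 2 c) = 3 := by
  have hcsq : c ^ 2 = 1 := hc ▸ pow_orderOf_eq_one c
  have hc1 : c ≠ 1 := fun h => by simp [h] at hc
  have hcneg : c = -1 := by
    have h : (c : ZMod q) * c = 1 := by
      rw [← sq, ← Units.val_pow_eq_pow_val, hcsq, Units.val_one]
    exact Units.ext ((mul_self_eq_one_iff.1 h).resolve_left (by simpa using hc1))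
  subst hcneg
  have h2 : (2 : ZMod q) ≠ 0 := fun h => hc1 (Units.ext (by
    push_cast
    linear_combination -h))
  refine IsGreatest.csSup_eq ⟨exists_three_generalPosition h2, ?_⟩
  rintro n ⟨M, hM, hgp⟩
  by_contra! hn
  refine not_generalPosition_four h2 (M ∘ Fin.castLE hn) (fun i => hM _)
    (generalPosition_iff.2 fun i => ?_)
  obtain ⟨g, hg, hgj⟩ := generalPosition_iff.1 hgp (Fin.castLE hn i)
  exact ⟨g, hg, fun j hj => hgj _ fun h => hj (Fin.castLE_injective hn h)⟩
end
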